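/- arXiv:1811.04429 — 3 statements merged into one kernel-verified Lean document; each statement's English description precedes it below -/
import Mathlib

section
/- Let G be a finite simple chordal graph and let B be an induced complete bipartite subgraph of G with parts B_X = {x} and B_Y = {y_1,...,y_k}. Let C be a connected component of the subgraph of G induced by M_2(B), and let w_1 and w_2 be two vertices of C. Then there exists a vertex w ∈ V(C) such that f(w_1) ∪ f(w_2) ⊆ f(w). -/
open SimpleGraph

/-- `N₁(S)`: the set of vertices at distance exactly 1 from the vertex set `S`. -/
def nOne {V : Type*} (G : SimpleGraph V) (S : Set V) : Set V :=
  {v | v ∉ S ∧ ∃ s ∈ S, G.Adj v s}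

/-- `N₂(S)`: the set of vertices at distance exactly 2 from the vertex set `S`. -/
def nTwo {V : Type*} (G : SimpleGraph V) (S : Set V) : Set V :=
  {v | v ∉ S ∧ (∀ s ∈ S, ¬ G.Adj v s) ∧ ∃ u, G.Adj v u ∧ ∃ s ∈ S, G.Adj u s}

/-- A graph is chordal if every induced cycle is a triangle, i.e. it has no
induced cycle of length at least 4. -/
def IsChordal {V : Type*} (G : SimpleGraph V) : Prop :=
  ∀ n : ℕ, 4 ≤ n → ∀ s : Set V, IsEmpty (G.induce s ≃g cycleGraph n)

/-- A set of vertices is independent if its elements are pairwise nonadjacent. -/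
def IsIndepSet {V : Type*} (G : SimpleGraph V) (S : Set V) : Prop :=
  S.Pairwise fun a b => ¬ G.Adj a b

/-- `B` is an induced complete bipartite subgraph of `G` with parts `B_X = {x}` and
`B_Y = Y`: `Y` is a nonempty independent set not containing `x`, and `x` is adjacent
to every vertex of `Y`. -/
def IsInducedStar {V : Type*} (G : SimpleGraph V) (x : V) (Y : Set V) : Prop :=
  Y.Nonempty ∧ x ∉ Y ∧ (∀ y ∈ Y, G.Adj x y) ∧ ∀ y₁ ∈ Y, ∀ y₂ ∈ Y, ¬ G.Adj y₁ y₂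

/-- `M₁(B_X) = N₁(B_X) ∩ N₂(B_Y)` where `B_X = {x}` and `B_Y = Y`. -/
def M1X {V : Type*} (G : SimpleGraph V) (x : V) (Y : Set V) : Set V :=
  nOne G {x} ∩ nTwo G Y

/-- `M₁(B_Y) = N₁(B_Y) ∩ N₂(B_X)`. -/
def M1Y {V : Type*} (G : SimpleGraph V) (x : V) (Y : Set V) : Set V :=
  nOne G Y ∩ nTwo G {x}

/-- `M₂(B_X) = N₁(M₁(B_X)) ∩ N₂(B_X)`. -/
def M2X {V : Type*} (G : SimpleGraph V) (x : V) (Y : Set V) : Set V :=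
  nOne G (M1X G x Y) ∩ nTwo G {x}

/-- `M₂(B_Y) = N₁(M₁(B_Y)) ∩ N₂(B_Y)`. -/
def M2Y {V : Type*} (G : SimpleGraph V) (x : V) (Y : Set V) : Set V :=
  nOne G (M1Y G x Y) ∩ nTwo G Y

/-- `M₁(B) = M₁(B_X) ∪ M₁(B_Y)`. -/
def M1B {V : Type*} (G : SimpleGraph V) (x : V) (Y : Set V) : Set V :=
  M1X G x Y ∪ M1Y G x Y

/-- `M₂(B) = M₂(B_X) ∪ M₂(B_Y)`. -/
def M2B {V : Type*} (G : SimpleGraph V) (x : V) (Y : Set V) : Set V :=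
  M2X G x Y ∪ M2Y G x Y

/-- `f(S) = N₁(S) ∩ M₁(B)`. -/
def fSet {V : Type*} (G : SimpleGraph V) (x : V) (Y : Set V) (S : Set V) : Set V :=
  nOne G S ∩ M1B G x Y

/-- The subgraph of `G` with edges restricted to the vertex set `W`
(the induced subgraph on `W`, viewed on the same vertex type). -/
def restrict {V : Type*} (G : SimpleGraph V) (W : Set V) : SimpleGraph V where
  Adj a b := G.Adj a b ∧ a ∈ W ∧ b ∈ W
  symm := ⟨fun _ _ ⟨h, ha, hb⟩ => ⟨h.symm, hb, ha⟩⟩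
  loopless := ⟨fun a ⟨h, _, _⟩ => G.loopless.irrefl a h⟩

/-- `C` is (the vertex set of) a connected component of the subgraph of `G`
induced by `W`. -/
def IsCompOf {V : Type*} (G : SimpleGraph V) (W C : Set V) : Prop :=
  C ⊆ W ∧ ∃ v ∈ C, C = {u | u ∈ W ∧ (restrict G W).Reachable u v}

theorem restrict_mono {V : Type*} (G : SimpleGraph V) {S T : Set V} (h : S ⊆ T) :
    restrict G S ≤ restrict G T :=
  fun _ _ hab => ⟨hab.1, h hab.2.1, h hab.2.2⟩

theorem restrict_reachable_of_adj {V : Type*} {G : SimpleGraph V} {S : Set V} {a b : V}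
    (h : G.Adj a b) (ha : a ∈ S) (hb : b ∈ S) : (restrict G S).Reachable a b :=
  Adj.reachable (G := restrict G S) ⟨h, ha, hb⟩

theorem mem_of_restrict_reachable {V : Type*} {G : SimpleGraph V} {S : Set V} {a b : V}
    (h : (restrict G S).Reachable a b) (ha : a ∈ S) : b ∈ S := by
  obtain ⟨p⟩ := h
  induction p with
  | nil => exact ha
  | cons h _ ih => exact ih h.2.2

/-- Adjacency in a cycle graph, in terms of the values of the vertices. -/
theorem cycleGraph_adj_iff_val {n : ℕ} {i j : Fin (n + 2)} :
    (cycleGraph (n + 2)).Adj i j ↔ i.val + 1 = j.val ∨ j.val + 1 = i.val ∨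
      (i.val = 0 ∧ j.val = n + 1) ∨ (j.val = 0 ∧ i.val = n + 1) := by
  have key : ∀ a b : Fin (n + 2), (a - b).val = 1 ↔
      b.val + 1 = a.val ∨ (a.val = 0 ∧ b.val = n + 1) := by
    intro a b
    have ha := a.isLt
    have hb := b.isLt
    rw [Fin.sub_def]
    dsimp only
    rcases Nat.lt_or_ge a.val b.val with hlt | hge
    · rw [Nat.mod_eq_of_lt (by omega)]
      omega
    · rw [Nat.mod_eq_sub_mod (by omega), Nat.mod_eq_of_lt (by omega)]
      omega
  rw [cycleGraph_adj', key, key]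
  tauto

/-- The vertices of a shortest walk are adjacent only when they are consecutive. -/
theorem getVert_adj_of_length_eq_dist {V : Type*} {H : SimpleGraph V} {p q : V} (w : H.Walk p q)
    (hw : w.length = H.dist p q) {i j : ℕ} (hij : i < j) (hj : j ≤ w.length)
    (h : H.Adj (w.getVert i) (w.getVert j)) : i + 1 = j := by
  have := dist_le ((w.take i).append (Walk.cons h (w.drop j)))
  rw [Walk.length_append, Walk.length_cons, Walk.take_length, Walk.drop_length] at this
  omega

/-- In a chordal graph, two neighbours of `v` that are joined by a walk whose interior avoids
the closed neighbourhood of `v` are adjacent. -/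
theorem IsChordal.adj_of_reachable_avoiding {V : Type*} {G : SimpleGraph V} (hG : IsChordal G)
    {v p q : V} {T : Set V} (hp : G.Adj v p) (hq : G.Adj v q) (hpT : p ∈ T)
    (hT : ∀ z ∈ T, (z ≠ v ∧ ¬ G.Adj v z) ∨ z = p ∨ z = q)
    (h : (restrict G T).Reachable p q) (hne : p ≠ q) : G.Adj p q := by
  by_contra hpq
  obtain ⟨w, hw⟩ := h.exists_walk_length_eq_dist
  have hpath := w.isPath_of_length_eq_dist hw
  have hmem : ∀ i, w.getVert i ∈ T := fun i =>
    mem_of_restrict_reachable ⟨w.take i⟩ hpT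
  have hinj : ∀ i j, i ≤ w.length → j ≤ w.length → w.getVert i = w.getVert j → i = j :=
    fun i j hi hj hij => hpath.getVert_injOn hi hj hij
  have hlen : 2 ≤ w.length := by
    by_contra hlt
    have hcase : w.length = 0 ∨ w.length = 1 := by omega
    rcases hcase with h0 | h1
    · exact hne (Walk.eq_of_length_eq_zero h0)
    · exact hpq (Walk.adj_of_length_eq_one h1).1
  have hnev : ∀ i, w.getVert i ≠ v := by
    intro i hi
    rcases hT _ (hmem i) with h1 | h1 | h1
    · exact h1.1 hi
    · exact hp.ne (hi.symm.trans h1)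
    · exact hq.ne (hi.symm.trans h1)
  have hadjv : ∀ i, i ≤ w.length → (G.Adj v (w.getVert i) ↔ i = 0 ∨ i = w.length) := by
    intro i hi
    constructor
    · intro ha
      rcases hT _ (hmem i) with h1 | h1 | h1
      · exact absurd ha h1.2
      · exact .inl (hinj i 0 hi (Nat.zero_le _) (by rw [h1, w.getVert_zero]))
      · exact .inr (hinj i w.length hi le_rfl (by rw [h1, w.getVert_length]))
    · rintro (rfl | rfl)
      · rwa [w.getVert_zero]
      · rwa [w.getVert_length]
  have hadj : ∀ i j, i < j → j ≤ w.length →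
      (G.Adj (w.getVert i) (w.getVert j) ↔ i + 1 = j) := by
    intro i j hij hj
    constructor
    · exact fun ha => getVert_adj_of_length_eq_dist w hw hij hj ⟨ha, hmem i, hmem j⟩
    · rintro rfl
      exact (w.adj_getVert_succ (by omega)).1
  let c : Fin (w.length + 2) → V := fun i => if i.val ≤ w.length then w.getVert i.val else v
  have hcinj : Function.Injective c := by
    intro i j hij
    have hi := i.isLt
    have hj := j.isLt
    apply Fin.ext
    by_cases h1 : i.val ≤ w.length <;> by_cases h2 : j.val ≤ w.length <;>
      simp only [c, h1, h2, if_true, if_false] at hij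
    · exact hinj _ _ h1 h2 hij
    · exact absurd hij (hnev _)
    · exact absurd hij.symm (hnev _)
    · omega
  have hc : ∀ i j : Fin (w.length + 2), i.val < j.val →
      (G.Adj (c i) (c j) ↔ (cycleGraph (w.length + 2)).Adj i j) := by
    intro i j hij
    have hj := j.isLt
    have h1 : i.val ≤ w.length := by omega
    rw [cycleGraph_adj_iff_val]
    by_cases h2 : j.val ≤ w.length <;> simp only [c, h1, h2, if_true, if_false]
    · rw [hadj _ _ hij h2]
      omega
    · rw [G.adj_comm, hadjv _ h1]
      omega
  let e : cycleGraph (w.length + 2) ↪g G :=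
    { toFun := c
      inj' := hcinj
      map_rel_iff' := by
        intro i j
        change G.Adj (c i) (c j) ↔ _
        rcases lt_trichotomy i.val j.val with hlt | heq | hgt
        · exact hc i j hlt
        · rw [Fin.ext heq]
          simp
        · rw [G.adj_comm, hc j i hgt, adj_comm] }
  exact (hG (w.length + 2) (by omega) _).false e.isoInduceRange.symm

/-- A chordal graph has no induced four-cycle. -/
theorem IsChordal.adj_of_common_neighbors {V : Type*} {G : SimpleGraph V} (hG : IsChordal G)
    {v z p q : V} (hvp : G.Adj v p) (hvq : G.Adj v q) (hzp : G.Adj z p) (hzq : G.Adj z q)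
    (hzv : z ≠ v) (hvz : ¬ G.Adj v z) (hne : p ≠ q) : G.Adj p q := by
  refine hG.adj_of_reachable_avoiding (T := {z, p, q}) hvp hvq (by simp) ?_ ?_ hne
  · rintro t (rfl | rfl | rfl)
    · exact .inl ⟨hzv, hvz⟩
    · exact .inr (.inl rfl)
    · exact .inr (.inr rfl)
  · exact (restrict_reachable_of_adj hzp.symm (by simp) (by simp)).trans
      (restrict_reachable_of_adj hzq (by simp) (by simp))

/-- In a chordal graph, if the ends of an edge outside `T` both have neighbours in the same
component of `T`, then they have a common neighbour in `T`. -/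
theorem IsChordal.exists_common_neighbor {V : Type*} {G : SimpleGraph V} (hG : IsChordal G)
    {a b u v : V} {T : Set V} (hab : G.Adj a b) (ha : a ∉ T) (hb : b ∉ T) (hu : u ∈ T)
    (h : (restrict G T).Reachable u v) (hau : G.Adj a u) (hbv : G.Adj b v) :
    ∃ t ∈ T, G.Adj a t ∧ G.Adj b t := by
  have close : ∀ s ∈ T, G.Adj a s →
      (restrict G ({z | z ≠ a ∧ ¬ G.Adj a z} ∪ {s, b})).Reachable s b →
      ∃ t ∈ T, G.Adj a t ∧ G.Adj b t := fun s hs has hr =>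
    ⟨s, hs, has, (hG.adj_of_reachable_avoiding has hab (.inr (.inl rfl)) (fun _ hz => hz) hr
      (fun hsb => hb (hsb ▸ hs))).symm⟩
  suffices H : (∃ t ∈ T, G.Adj a t ∧ G.Adj b t) ∨
      (restrict G ({z | z ≠ a ∧ ¬ G.Adj a z} ∪ {u, b})).Reachable u b from
    H.elim id (close u hu hau)
  clear hau
  obtain ⟨p⟩ := h
  induction p with
  | nil => exact .inr (restrict_reachable_of_adj hbv.symm (by simp) (by simp))
  | @cons s t _ hst _ ih =>
    rcases ih hst.2.2 hbv with hdone | hr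
    · exact .inl hdone
    by_cases hat : G.Adj a t
    · exact .inl (close t hst.2.2 hat hr)
    · have hta : t ≠ a := fun e => ha (e ▸ hst.2.2)
      refine .inr ((restrict_reachable_of_adj hst.1 (by simp) (.inl ⟨hta, hat⟩)).trans
        (hr.mono (restrict_mono G ?_)))
      rintro z (hz | rfl | rfl)
      · exact .inl hz
      · exact .inl ⟨hta, hat⟩
      · exact .inr (by simp)

/-- A walk to a neighbour of `b` can be cut at the first neighbour of `b`. -/
theorem exists_reachable_first_neighbor {V : Type*} {G : SimpleGraph V} {b u v : V} {T : Set V}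
    (hu : u ∈ T) (h : (restrict G T).Reachable u v) (hbv : G.Adj b v) :
    ∃ p ∈ T, G.Adj b p ∧
      (restrict G ({z | z ∈ T ∧ ¬ G.Adj b z} ∪ {p})).Reachable u p := by
  obtain ⟨w⟩ := h
  induction w with
  | @nil s => exact ⟨s, hu, hbv, .rfl⟩
  | @cons s t _ hst _ ih =>
    by_cases hbs : G.Adj b s
    · exact ⟨s, hu, hbs, .rfl⟩
    obtain ⟨p, hp, hbp, hr⟩ := ih hst.2.2 hbv
    refine ⟨p, hp, hbp, (restrict_reachable_of_adj hst.1 (.inl ⟨hu, hbs⟩) ?_).trans hr⟩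
    exact mem_of_restrict_reachable hr.symm (.inr rfl)

/-- In a chordal graph, let `K` and `L` be sets outside `C` that are completely joined to each
other, `K` joined to `w₁` and `L` joined to `w₂`, where `w₁` and `w₂` lie in the same component
of `C`. Then some vertex of `C` is joined to all of `K ∪ L`. -/
theorem IsChordal.exists_complete {V : Type*} {G : SimpleGraph V} (hG : IsChordal G)
    {C K L : Set V} {w₁ w₂ : V} (hK : ∀ a ∈ K, a ∉ C) (hL : ∀ b ∈ L, b ∉ C)
    (hKL : ∀ a ∈ K, ∀ b ∈ L, a ≠ b → G.Adj a b) (hw : w₁ ∈ C)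
    (h : (restrict G C).Reachable w₁ w₂)
    (h₁ : ∀ a ∈ K, G.Adj a w₁) (h₂ : ∀ b ∈ L, G.Adj b w₂) :
    ∃ w ∈ C, ∀ m ∈ K ∪ L, G.Adj m w := by
  let D : Set V := {z | z ∈ C ∧ ¬ ∀ a ∈ K, G.Adj a z}
  suffices H : (∃ w ∈ C, ∀ m ∈ K ∪ L, G.Adj m w) ∨
      (w₁ ∈ D ∧ (restrict G D).Reachable w₁ w₂) from
    H.elim id fun hd => absurd h₁ hd.1.2
  clear h₁
  obtain ⟨p⟩ := h
  induction p with
  | @nil s =>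
    by_cases hs : ∀ a ∈ K, G.Adj a s
    · exact .inl ⟨s, hw, fun m hm => hm.elim (hs m) (h₂ m)⟩
    · exact .inr ⟨⟨hw, hs⟩, .rfl⟩
  | @cons s t r hst _ ih =>
    rcases ih hst.2.2 h₂ with hdone | ⟨ht, hr⟩
    · exact .inl hdone
    by_cases hs : ∀ a ∈ K, G.Adj a s
    swap
    · have hsD : s ∈ D := ⟨hw, hs⟩
      exact .inr ⟨hsD, (restrict_reachable_of_adj hst.1 hsD ht).trans hr⟩
    refine .inl ⟨s, hw, fun m hm => hm.elim (hs m) fun hb => ?_⟩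
    by_contra hms
    have hr' : (restrict G (insert s D)).Reachable s r :=
      (restrict_reachable_of_adj hst.1 (by simp) (.inr ht)).trans
        (hr.mono (restrict_mono G (Set.subset_insert _ _)))
    obtain ⟨p, hp, hmp, hsp⟩ :=
      exists_reachable_first_neighbor (Set.mem_insert s D) hr' (h₂ m hb)
    have hpD : p ∈ D := hp.resolve_left fun e => hms (e ▸ hmp)
    obtain ⟨a, ha, hap⟩ : ∃ a ∈ K, ¬ G.Adj a p := by
      simpa using hpD.2
    have ham : G.Adj a m := hKL a ha m hb fun e => hap (e ▸ hmp)
    have hsub : {z | z ∈ insert s D ∧ ¬ G.Adj m z} ∪ {p} ⊆ C := by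
      rintro z (⟨rfl | hz, _⟩ | rfl)
      · exact hw
      · exact hz.1
      · exact hpD.1
    obtain ⟨z, hz, haz, hmz⟩ := hG.exists_common_neighbor ham
      (fun e => hK a ha (hsub e)) (fun e => hL m hb (hsub e))
      (.inl ⟨Set.mem_insert s D, hms⟩) hsp (hs a ha) hmp
    rcases hz with hz | rfl
    · exact hz.2 hmz
    · exact hap haz

theorem mem_fSet_singleton {V : Type*} {G : SimpleGraph V} {x : V} {Y : Set V} {w m : V} :
    m ∈ fSet G x Y {w} ↔ G.Adj m w ∧ m ∈ M1B G x Y := by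
  simp only [fSet, nOne, Set.mem_inter_iff, Set.mem_ofPred_eq, Set.mem_singleton_iff,
    exists_eq_left]
  exact ⟨fun h => ⟨h.1.2, h.2⟩, fun h => ⟨⟨h.1.ne, h.1⟩, h.2⟩⟩

/-- A vertex of `M₁(B)` is adjacent to exactly one side of `B`. -/
theorem adj_of_mem_M1B {V : Type*} {G : SimpleGraph V} {x : V} {Y : Set V} {m : V}
    (hm : m ∈ M1B G x Y) :
    m ≠ x ∧ m ∉ Y ∧ ((G.Adj x m ∧ ∀ y ∈ Y, ¬ G.Adj y m) ∨
      (¬ G.Adj x m ∧ ∃ y ∈ Y, G.Adj y m)) := by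
  rcases hm with ⟨⟨h1, s, rfl, h2⟩, h3, h4, _⟩ | ⟨⟨h1, s, hs, h2⟩, h3, h4, _⟩
  · exact ⟨h1, h3, .inl ⟨h2.symm, fun y hy h => h4 y hy h.symm⟩⟩
  · exact ⟨h3, h1, .inr ⟨fun h => h4 x rfl h.symm, s, hs, h2.symm⟩⟩

/-- No vertex of `M₂(B)` lies in `B` or is adjacent to a vertex of `B`. -/
theorem IsChordal.not_adj_of_mem_M2B {V : Type*} {G : SimpleGraph V} (hG : IsChordal G)
    {x : V} {Y : Set V} (hB : IsInducedStar G x Y) {w : V} (hw : w ∈ M2B G x Y) :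
    ∀ v ∈ insert x Y, w ≠ v ∧ ¬ G.Adj v w := by
  obtain ⟨⟨y₁, hy₁⟩, -, hxY, -⟩ := hB
  rcases hw with ⟨⟨-, m, hm, hwm⟩, hwx, hwx', -⟩ | ⟨⟨-, m, hm, hwm⟩, hwY, hwY', -⟩
  · obtain ⟨⟨-, s, rfl, hmx⟩, hmY, hmY', -⟩ := hm
    have hsw : ¬ G.Adj s w := fun h => hwx' s rfl h.symm
    rintro v (rfl | hv)
    · exact ⟨hwx, hsw⟩
    · refine ⟨fun e => hsw (e ▸ hxY v hv), fun h => ?_⟩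
      exact hmY' v hv (hG.adj_of_common_neighbors hmx.symm (hxY v hv) hwm h.symm hwx hsw
        fun e => hmY (e ▸ hv))
  · obtain ⟨⟨-, y, hy, hmy⟩, hmx, hmx', -⟩ := hm
    rintro v (rfl | hv)
    · refine ⟨fun e => hwY' y₁ hy₁ (e ▸ hxY y₁ hy₁), fun h => ?_⟩
      exact hmx' v rfl (hG.adj_of_common_neighbors h.symm hwm (hxY y hy).symm hmy.symm
        (fun e => hwY (e ▸ hy)) (hwY' y hy) (Ne.symm hmx)).symm
    · exact ⟨fun e => hwY (e ▸ hv), fun h => hwY' v hv h.symm⟩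

/-- The neighbours in `M₁(B)` of a connected subset of `M₂(B)` form a clique. -/
theorem IsChordal.adj_of_adj_M2B {V : Type*} {G : SimpleGraph V} (hG : IsChordal G)
    {x : V} {Y : Set V} (hB : IsInducedStar G x Y) {a b u v : V} (ha : a ∈ M1B G x Y)
    (hb : b ∈ M1B G x Y) (hu : u ∈ M2B G x Y)
    (h : (restrict G (M2B G x Y)).Reachable u v) (hau : G.Adj a u) (hbv : G.Adj b v)
    (hne : a ≠ b) : G.Adj a b := by
  have hC := fun w hw => hG.not_adj_of_mem_M2B hB (w := w) hw
  have hv := mem_of_restrict_reachable h hu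
  have hab : ∀ T, M2B G x Y ∪ {a, b} ⊆ T → (restrict G T).Reachable a b := fun T hT =>
    ((restrict_reachable_of_adj hau (hT (by simp)) (hT (.inl hu))).trans
      (h.mono (restrict_mono G fun z hz => hT (.inl hz)))).trans
      (restrict_reachable_of_adj hbv.symm (hT (.inl hv)) (hT (by simp)))
  have same : ∀ s ∈ insert x Y, G.Adj s a → G.Adj s b → G.Adj a b := fun s hs hsa hsb =>
    hG.adj_of_reachable_avoiding (T := M2B G x Y ∪ {a, b}) hsa hsb (by simp)
      (fun z hz => hz.imp (fun hz => hC z hz s hs) id) (hab _ subset_rfl) hne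
  have mixed : ∀ c d : V, c ∈ M1B G x Y → d ∈ M1B G x Y → G.Adj x c →
      (∀ y ∈ Y, ¬ G.Adj y c) → ¬ G.Adj x d → (∃ y ∈ Y, G.Adj y d) →
      (∀ T, M2B G x Y ∪ {c, d} ⊆ T → (restrict G T).Reachable c d) → False := by
    rintro c d hc hd hxc hcY hxd ⟨y, hy, hyd⟩ hr
    refine hcY y hy (hG.adj_of_reachable_avoiding (T := M2B G x Y ∪ {c, d} ∪ {y}) hxc
      (hB.2.2.1 y hy) (by simp) ?_ ((hr _ Set.subset_union_left).trans
        (restrict_reachable_of_adj hyd.symm (by simp) (by simp)))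
        fun e => (adj_of_mem_M1B hc).2.1 (e ▸ hy)).symm
    rintro z ((hz | rfl | rfl) | rfl)
    · exact .inl (hC z hz x (by simp))
    · exact .inr (.inl rfl)
    · exact .inl ⟨(adj_of_mem_M1B hd).1, hxd⟩
    · exact .inr (.inr rfl)
  rcases (adj_of_mem_M1B ha).2.2 with ⟨hxa, haY⟩ | ⟨hxa, y, hy, hya⟩ <;>
    rcases (adj_of_mem_M1B hb).2.2 with ⟨hxb, hbY⟩ | ⟨hxb, y', hy', hyb⟩
  · exact same x (by simp) hxa hxb
  · exact (mixed a b ha hb hxa haY hxb ⟨y', hy', hyb⟩ hab).elim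
  · exact (mixed b a hb ha hxb hbY hxa ⟨y, hy, hya⟩
      fun T hT => (hab T (by rwa [Set.pair_comm])).symm).elim
  · by_cases e : y = y'
    · exact same y (by simp [hy]) hya (e ▸ hyb)
    refine (hB.2.2.2 y hy y' hy' (hG.adj_of_reachable_avoiding
      (T := M2B G x Y ∪ {a, b} ∪ {y, y'}) (hB.2.2.1 y hy) (hB.2.2.1 y' hy') (by simp) ?_
      (((restrict_reachable_of_adj hya (by simp) (by simp)).trans
        (hab _ Set.subset_union_left)).trans
        (restrict_reachable_of_adj hyb.symm (by simp) (by simp))) e)).elim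
    rintro z ((hz | rfl | rfl) | hz)
    · exact .inl (hC z hz x (by simp))
    · exact .inl ⟨(adj_of_mem_M1B ha).1, hxa⟩
    · exact .inl ⟨(adj_of_mem_M1B hb).1, hxb⟩
    · exact .inr hz

/-- A component is connected by walks that stay inside it. -/
theorem IsCompOf.reachable {V : Type*} {G : SimpleGraph V} {W C : Set V} (hC : IsCompOf G W C)
    {u v : V} (hu : u ∈ C) (hv : v ∈ C) : (restrict G C).Reachable u v := by
  obtain ⟨-, c, -, hCc⟩ := hC
  have hmem : ∀ z, z ∈ C ↔ z ∈ W ∧ (restrict G W).Reachable z c := fun z => by rw [hCc]; rfl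
  obtain ⟨p⟩ := ((hmem u).1 hu).2.trans ((hmem v).1 hv).2.symm
  clear hv hCc
  induction p with
  | nil => exact .rfl
  | @cons s t _ hst _ ih =>
    have ht : t ∈ C := (hmem t).2 ⟨hst.2.2,
      (Adj.reachable (G := restrict G W) hst).symm.trans ((hmem s).1 hu).2⟩
    exact (restrict_reachable_of_adj hst.1 hu ht).trans (ih ht)

/-- For any two vertices `w₁, w₂` of a connected component `C` of the subgraph of `G`
induced by `M₂(B)`, there is a vertex `w ∈ C` with `f(w₁) ∪ f(w₂) ⊆ f(w)`. -/
theorem stmt9 {V : Type*} (G : SimpleGraph V) (hG : IsChordal G)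
    (x : V) (Y : Set V) (hB : IsInducedStar G x Y)
    (C : Set V) (hC : IsCompOf G (M2B G x Y) C)
    (w₁ w₂ : V) (hw₁ : w₁ ∈ C) (hw₂ : w₂ ∈ C) :
    ∃ w ∈ C, fSet G x Y {w₁} ∪ fSet G x Y {w₂} ⊆ fSet G x Y {w} := by
  have hr := hC.reachable hw₁ hw₂
  have hM : ∀ m ∈ M1B G x Y, m ∉ C := by
    intro m hm hmC
    have hB' := hG.not_adj_of_mem_M2B hB (hC.1 hmC)
    rcases (adj_of_mem_M1B hm).2.2 with ⟨h, -⟩ | ⟨-, y, hy, h⟩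
    · exact (hB' x (by simp)).2 h
    · exact (hB' y (by simp [hy])).2 h
  obtain ⟨w, hw, h⟩ := hG.exists_complete (K := fSet G x Y {w₁}) (L := fSet G x Y {w₂})
    (fun a ha => hM a ha.2) (fun b hb => hM b hb.2)
    (fun a ha b hb hne => hG.adj_of_adj_M2B hB ha.2 hb.2 (hC.1 hw₁)
      (hr.mono (restrict_mono G hC.1)) (mem_fSet_singleton.1 ha).1 (mem_fSet_singleton.1 hb).1 hne)
    hw₁ hr (fun a ha => (mem_fSet_singleton.1 ha).1) (fun b hb => (mem_fSet_singleton.1 hb).1)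
  exact ⟨w, hw, fun m hm => mem_fSet_singleton.2 ⟨h m hm, hm.elim And.right And.right⟩⟩
end

section
/- Let G be a finite simple chordal graph and let B be an induced complete bipartite subgraph of G with parts B_X = {x} and B_Y = {y_1,...,y_k}. Let S be a set of vertices containing exactly one vertex w_C from each connected component C of the subgraph of G induced by M_2(B), chosen so that f(w_C) = f(V(C)). Then S is an independent set, and for every independent set S' ⊆ M_2(B), N_1(S') ∩ M_1(B) ⊆ N_1(S) ∩ M_1(B). -/
open SimpleGraph

/-- A chordal graph has no induced cycle `a b c d` of length four. -/
theorem IsChordal.false_of_four_cycle {V : Type*} {G : SimpleGraph V} (hG : IsChordal G)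
    {a b c d : V} (hab : G.Adj a b) (hbc : G.Adj b c) (hcd : G.Adj c d) (hda : G.Adj d a)
    (hac : ¬ G.Adj a c) (hbd : ¬ G.Adj b d) (hne : a ≠ c) (hne' : b ≠ d) : False := by
  have hinj : Function.Injective ![a, b, c, d] := by
    have h₁ := hab.ne
    have h₂ := hbc.ne
    have h₃ := hcd.ne
    have h₄ := hda.ne
    intro i j hij
    fin_cases i <;> fin_cases j <;> simp_all
  have hadj : ∀ i j, G.Adj (![a, b, c, d] i) (![a, b, c, d] j) ↔ (cycleGraph 4).Adj i j := by
    have hca : ¬ G.Adj c a := fun h => hac h.symm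
    have hdb : ¬ G.Adj d b := fun h => hbd h.symm
    intro i j
    rw [cycleGraph_adj]
    fin_cases i <;> fin_cases j <;>
      simp [hab, hbc, hcd, hda, hab.symm, hbc.symm, hcd.symm, hda.symm, hac, hbd, hca, hdb] <;>
      decide
  let e : cycleGraph 4 ≃g G.induce (Set.range ![a, b, c, d]) :=
    ⟨Equiv.ofInjective _ hinj, fun {i j} => hadj i j⟩
  exact (hG 4 le_rfl _).false e.symm

/-- In a chordal graph, `M₁(B)` and `M₂(B)` are disjoint. -/
theorem IsChordal.disjoint_M1B_M2B {V : Type*} {G : SimpleGraph V} (hG : IsChordal G)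
    {x : V} {Y : Set V} (hB : IsInducedStar G x Y) : Disjoint (M1B G x Y) (M2B G x Y) := by
  rw [Set.disjoint_left]
  rintro v (⟨⟨-, _, rfl, hvx⟩, hvY, hvnY, -⟩ | ⟨⟨-, y, hy, hvy⟩, hvx, hvnx, -⟩)
    (⟨⟨-, u, hu, hvu⟩, h₂⟩ | ⟨⟨-, u, hu, hvu⟩, h₂⟩)
  · exact h₂.2.1 _ rfl hvx
  · obtain ⟨⟨-, y, hy, huy⟩, hux, hunx, -⟩ := hu
    exact hG.false_of_four_cycle hvu huy (hB.2.2.1 y hy).symm hvx.symm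
      (hvnY y hy) (hunx _ rfl) (fun h => hvY (h ▸ hy)) hux
  · obtain ⟨⟨-, _, rfl, hux⟩, huY, hunY, -⟩ := hu
    exact hG.false_of_four_cycle hvu hux (hB.2.2.1 y hy) hvy.symm
      (hvnx _ rfl) (hunY y hy) hvx (fun h => huY (h ▸ hy))
  · exact h₂.2.1 y hy hvy

/-- Every vertex of `W` lies in its connected component of the subgraph induced by `W`. -/
theorem isCompOf_reachable {V : Type*} (G : SimpleGraph V) {W : Set V} {v : V} (hv : v ∈ W) :
    IsCompOf G W {u | u ∈ W ∧ (restrict G W).Reachable u v} :=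
  ⟨fun _ h => h.1, v, ⟨hv, Reachable.rfl⟩, rfl⟩

/-- Let `S` contain exactly one vertex `w_C` from each connected component `C` of the
subgraph of `G` induced by `M₂(B)`, chosen so that `f(w_C) = f(V(C))`. Then `S` is
independent, and for every independent set `S' ⊆ M₂(B)` we have
`N₁(S') ∩ M₁(B) ⊆ N₁(S) ∩ M₁(B)`. -/
theorem stmt11 {V : Type*} (G : SimpleGraph V) (hG : IsChordal G)
    (x : V) (Y : Set V) (hB : IsInducedStar G x Y)
    (S : Set V) (hS1 : S ⊆ M2B G x Y)
    (hS2 : ∀ C, IsCompOf G (M2B G x Y) C →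
      ∃ w, w ∈ S ∧ w ∈ C ∧ (∀ w' ∈ S, w' ∈ C → w' = w) ∧
        fSet G x Y {w} = fSet G x Y C) :
    _root_.IsIndepSet G S ∧
      ∀ S' ⊆ M2B G x Y, _root_.IsIndepSet G S' →
        nOne G S' ∩ M1B G x Y ⊆ nOne G S ∩ M1B G x Y := by
  refine ⟨fun a ha b hb hne hab => hne ?_, ?_⟩
  · obtain ⟨w, -, -, hw, -⟩ := hS2 _ (isCompOf_reachable G (hS1 hb))
    have hr : (restrict G (M2B G x Y)).Adj a b := ⟨hab, hS1 ha, hS1 hb⟩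
    exact (hw a ha ⟨hS1 ha, hr.reachable⟩).trans (hw b hb ⟨hS1 hb, Reachable.rfl⟩).symm
  · rintro S' hS' - v ⟨⟨-, s, hs, hvs⟩, hv⟩
    have hv₂ : v ∉ M2B G x Y := Set.disjoint_left.mp (hG.disjoint_M1B_M2B hB) hv
    obtain ⟨w, hwS, -, -, hf⟩ := hS2 _ (isCompOf_reachable G (hS' hs))
    obtain ⟨⟨-, _, rfl, hvw⟩, -⟩ : v ∈ fSet G x Y {w} :=
      hf ▸ ⟨⟨fun h => hv₂ h.1, s, ⟨hS' hs, Reachable.rfl⟩, hvs⟩, hv⟩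
    exact ⟨⟨fun h => hv₂ (hS1 h), _, hwS, hvw⟩, hv⟩
end

section
/- Let G be a finite simple chordal graph. Then dim WCW(G) = sc(G); that is, the dimension of the vector space of weight functions w for which G is w-well-covered equals the number of simplicial cliques of G, and {f_C : C a simplicial clique of G} is a basis of WCW(G). -/
open SimpleGraph

/-- A maximal independent set of `G`, as a finset. -/
def IsMaxIndepF {V : Type*} (G : SimpleGraph V) (A : Finset V) : Prop :=
  _root_.IsIndepSet G ↑A ∧ ∀ B : Finset V, _root_.IsIndepSet G ↑B → A ⊆ B → A = B

/-- `G` is `w`-well-covered: all maximal independent sets of `G` have the same weight. -/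
def IsWWellCovered {V : Type*} (G : SimpleGraph V) (w : V → ℝ) : Prop :=
  ∀ A B : Finset V, IsMaxIndepF G A → IsMaxIndepF G B → ∑ v ∈ A, w v = ∑ v ∈ B, w v

/-- A vertex is simplicial if its closed neighborhood is a clique. -/
def IsSimplicialVertex {V : Type*} (G : SimpleGraph V) (v : V) : Prop :=
  G.IsClique (insert v (G.neighborSet v))

/-- A simplicial clique is a maximal clique containing a simplicial vertex. -/
def IsSimplicialClique {V : Type*} (G : SimpleGraph V) (C : Set V) : Prop :=
  G.IsClique C ∧ (∀ D, G.IsClique D → C ⊆ D → C = D) ∧ ∃ v ∈ C, IsSimplicialVertex G v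

/-- Along a walk of minimal length, vertices at different positions are distinct, and
adjacent ones are consecutive. -/
theorem Walk.index_le_of_length_eq_dist {V : Type*} {H : SimpleGraph V} {x y : V}
    (p : H.Walk x y) (hp : p.length = H.dist x y) {i j : ℕ} 
    (hj : j ≤ p.length) (q : H.Walk (p.getVert i) (p.getVert j)) : j ≤ i + q.length := by
  have h := SimpleGraph.dist_le (((p.take i).append q).append (p.drop j))
  rw [← hp, Walk.length_append, Walk.length_append, Walk.take_length, Walk.drop_length] at h
  omega

theorem spanningCoe_induce_adj {V : Type*} {G : SimpleGraph V} {W : Set V} {u v : V} :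
    (G.induce W).spanningCoe.Adj u v ↔ G.Adj u v ∧ u ∈ W ∧ v ∈ W := by
  simp only [map_adj, comap_adj, Function.Embedding.subtype_apply, Subtype.exists]
  constructor
  · rintro ⟨u, hu, v, hv, h, rfl, rfl⟩
    exact ⟨h, hu, hv⟩
  · rintro ⟨h, hu, hv⟩
    exact ⟨u, hu, v, hv, h, rfl, rfl⟩

/-- In a chordal graph, two neighbours of `b` that are joined by a walk whose inner vertices
avoid the closed neighbourhood of `b` are adjacent. -/
theorem IsChordal.adj_of_reachable {V : Type*} {G : SimpleGraph V} (hG : IsChordal G)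
    {W : Set V} {b x y : V} (hxy : x ≠ y) (hbx : G.Adj b x) (hby : G.Adj b y)
    (hW : ∀ v ∈ W, v ≠ b ∧ (G.Adj b v → v = x ∨ v = y))
    (hr : (G.induce W).spanningCoe.Reachable x y) : G.Adj x y := by
  by_contra hn
  set H := (G.induce W).spanningCoe
  have hadj : ∀ u v, H.Adj u v ↔ G.Adj u v ∧ u ∈ W ∧ v ∈ W :=
    fun u v => spanningCoe_induce_adj
  obtain ⟨p, hp⟩ := hr.exists_walk_length_eq_dist
  have hlen0 : p.length ≠ 0 := fun h => hxy (Walk.eq_of_length_eq_zero h)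
  have hstep : ∀ i, i < p.length → H.Adj (p.getVert i) (p.getVert (i + 1)) :=
    fun i hi => p.adj_getVert_succ hi
  have hlen1 : p.length ≠ 1 := by
    intro h
    have := hstep 0 (by omega)
    rw [Walk.getVert_zero, zero_add, ← h, Walk.getVert_length] at this
    exact hn ((hadj _ _).1 this).1
  have hmem : ∀ i, i ≤ p.length → p.getVert i ∈ W := by
    intro i hi
    rcases hi.lt_or_eq with h | h
    · exact ((hadj _ _).1 (hstep i h)).2.1
    · obtain ⟨k, rfl⟩ : ∃ k, i = k + 1 := ⟨i - 1, by omega⟩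
      exact ((hadj _ _).1 (hstep k (by omega))).2.2
  have hinj : ∀ i j, i ≤ j → j ≤ p.length → p.getVert i = p.getVert j → i = j := by
    intro i j hij hj h
    have := Walk.index_le_of_length_eq_dist p hp hj (Walk.nil.copy rfl h)
    simp at this
    omega
  have hchord : ∀ i j, i ≤ j → j ≤ p.length → G.Adj (p.getVert i) (p.getVert j) →
      j = i + 1 := by
    intro i j hij hj h
    have := Walk.index_le_of_length_eq_dist p hp hj
      (((hadj _ _).2 ⟨h, hmem i (by omega), hmem j hj⟩).toWalk)
    simp at this
    have : i ≠ j := by rintro rfl; exact h.ne rfl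
    omega
  have hb : ∀ i, i ≤ p.length → (G.Adj b (p.getVert i) ↔ i = 0 ∨ i = p.length) := by
    intro i hi
    constructor
    · intro h
      rcases (hW _ (hmem i hi)).2 h with h | h
      · exact .inl (hinj 0 i (by omega) hi (by simp [h])).symm
      · exact .inr (hinj i _ hi le_rfl (by simp [h]))
    · rintro (rfl | rfl)
      · simpa using hbx
      · simpa using hby
  let f : Fin (p.length + 2) → V := fun i => if i.val ≤ p.length then p.getVert i.val else b
  have hfinj : Function.Injective f := by
    intro i j hij
    by_cases hi : i.val ≤ p.length <;> by_cases hj : j.val ≤ p.length <;>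
      simp only [f, hi, hj, if_true, if_false] at hij
    · rcases le_total i.val j.val with h | h
      · exact Fin.ext (hinj _ _ h hj hij)
      · exact Fin.ext (hinj _ _ h hi hij.symm).symm
    · exact absurd hij (hW _ (hmem _ hi)).1
    · exact absurd hij.symm (hW _ (hmem _ hj)).1
    · ext; omega
  have hsub : ∀ i j : Fin (p.length + 2), (i - j).val = 1 ↔
      i.val = j.val + 1 ∨ (i.val = 0 ∧ j.val = p.length + 1) := by
    intro i j
    rw [Fin.val_sub]
    have := i.2
    have := j.2
    rcases le_or_gt j.val i.val with h | h
    · rw [show p.length + 2 - j.val + i.val = (i.val - j.val) + (p.length + 2) by omega,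
        Nat.add_mod_right, Nat.mod_eq_of_lt (by omega)]
      omega
    · rw [Nat.mod_eq_of_lt (by omega)]
      omega
  have hfadj : ∀ i j, G.Adj (f i) (f j) ↔ (cycleGraph (p.length + 2)).Adj i j := by
    intro i j
    rw [cycleGraph_adj', hsub, hsub]
    have := i.2
    have := j.2
    by_cases hi : i.val ≤ p.length <;> by_cases hj : j.val ≤ p.length <;>
      simp only [f, hi, hj, if_true, if_false]
    · constructor
      · intro h
        rcases le_total i.val j.val with hij | hij
        · have := hchord _ _ hij hj h
          omega
        · have := hchord _ _ hij hi h.symm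
          omega
      · rintro ((h | h) | (h | h))
        · rw [h]
          exact ((hadj _ _).1 (hstep j.val (by omega))).1.symm
        · omega
        · rw [h]
          exact ((hadj _ _).1 (hstep i.val (by omega))).1
        · omega
    · rw [G.adj_comm, hb _ hi]
      omega
    · rw [hb _ hj]
      omega
    · simp only [SimpleGraph.irrefl, false_iff]
      omega
  let e : cycleGraph (p.length + 2) ↪g G := ⟨⟨f, hfinj⟩, by intro i j; exact hfadj i j⟩
  exact (hG _ (by omega) _).false e.isoInduceRange.symm

/-- `v` is a simplicial vertex of the subgraph of `G` induced by `U`. -/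
def IsSimplicialIn {V : Type*} (G : SimpleGraph V) (U : Set V) (v : V) : Prop :=
  v ∈ U ∧ G.IsClique (U ∩ G.neighborSet v)

/-- Dirac's lemma: a chordal graph has a simplicial vertex outside any clique that does not
cover it. -/
theorem IsChordal.exists_isSimplicialIn {V : Type*} [Finite V] {G : SimpleGraph V}
    (hG : IsChordal G) (U : Set V) :
    ∀ Q : Set V, G.IsClique Q → ¬ U ⊆ Q → ∃ v, v ∉ Q ∧ IsSimplicialIn G U v := by
  induction U using WellFoundedLT.induction with
  | _ U ih =>
  have key : ∀ b ∈ U, ∀ a ∈ U, a ≠ b → ¬ G.Adj b a →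
      ∃ v, v ≠ b ∧ ¬ G.Adj b v ∧ IsSimplicialIn G U v := by
    intro b hb a ha hab hba
    set W : Set V := {v | v ∈ U ∧ v ≠ b ∧ ¬ G.Adj b v}
    set K : Set V := {v | v ∈ W ∧ (G.induce W).spanningCoe.Reachable a v}
    set N : Set V := {v | v ∈ U ∧ G.Adj b v ∧ ∃ k ∈ K, G.Adj k v}
    have haK : a ∈ K := ⟨⟨ha, hab, hba⟩, Reachable.rfl⟩
    have hNc : G.IsClique N := by
      rintro x ⟨-, hbx, k, hk, hkx⟩ y ⟨-, hby, l, hl, hly⟩ hxy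
      refine hG.adj_of_reachable (W := W ∪ {x, y}) hxy hbx hby ?_ ?_
      · rintro v (hv | rfl | rfl)
        · exact ⟨hv.2.1, fun h => absurd h hv.2.2⟩
        · exact ⟨hbx.ne', fun _ => .inl rfl⟩
        · exact ⟨hby.ne', fun _ => .inr rfl⟩
      · have hle : (G.induce W).spanningCoe ≤ (G.induce (W ∪ {x, y})).spanningCoe := by
          intro u v h
          rw [spanningCoe_induce_adj] at h ⊢
          exact ⟨h.1, .inl h.2.1, .inl h.2.2⟩
        have hkl := ((hk.2.symm.trans hl.2).mono hle)
        have hxk : (G.induce (W ∪ {x, y})).spanningCoe.Adj x k :=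
          spanningCoe_induce_adj.2 ⟨hkx.symm, .inr (by simp), .inl hk.1⟩
        have hly' : (G.induce (W ∪ {x, y})).spanningCoe.Adj l y :=
          spanningCoe_induce_adj.2 ⟨hly, .inl hl.1, .inr (by simp)⟩
        exact hxk.reachable.trans (hkl.trans hly'.reachable)
    have hsub : K ∪ N ⊆ U := by
      rintro v (h | h)
      · exact h.1.1
      · exact h.1
    have hlt : K ∪ N < U := by
      refine lt_of_le_of_ne hsub fun h => ?_
      rcases h.symm ▸ hb with h | h
      · exact h.1.2.1 rfl
      · exact h.2.1.ne rfl
    obtain ⟨v, hvN, hv, hvc⟩ := ih _ hlt N hNc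
      fun h => hba (h (.inl haK)).2.1
    have hvK : v ∈ K := hv.resolve_right hvN
    refine ⟨v, hvK.1.2.1, hvK.1.2.2, hsub hv, hvc.subset ?_⟩
    rintro u ⟨huU, hvu⟩
    refine ⟨?_, hvu⟩
    by_cases hbu : G.Adj b u
    · exact .inr ⟨huU, hbu, v, hvK, hvu⟩
    · have huW : u ∈ W := by
        refine ⟨huU, ?_, hbu⟩
        rintro rfl
        exact hvK.1.2.2 (G.adj_symm hvu)
      refine .inl ⟨huW, hvK.2.trans (Adj.reachable ?_)⟩
      exact spanningCoe_induce_adj.2 ⟨hvu, hvK.1, huW⟩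
  intro Q hQ hUQ
  by_cases hU : G.IsClique U
  · obtain ⟨v, hv, hvQ⟩ := Set.not_subset.1 hUQ
    exact ⟨v, hvQ, hv, hU.subset Set.inter_subset_left⟩
  by_cases hbQ : ∃ b ∈ U, b ∈ Q ∧ ∃ a ∈ U, a ≠ b ∧ ¬ G.Adj b a
  · obtain ⟨b, hb, hbQ, a, ha, hab, hn⟩ := hbQ
    obtain ⟨v, hvb, hbv, hv⟩ := key b hb a ha hab hn
    exact ⟨v, fun hvQ => hbv (hQ hbQ hvQ hvb.symm), hv⟩
  · push Not at hbQ
    obtain ⟨b, hb, a, ha, hab, hn⟩ : ∃ b ∈ U, ∃ a ∈ U, a ≠ b ∧ ¬ G.Adj b a := by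
      by_contra! h
      exact hU fun x hx y hy hxy => h x hx y hy hxy.symm
    obtain ⟨v, hvb, hbv, hv⟩ := key b hb a ha hab hn
    exact ⟨v, fun hvQ => hbv (hbQ v hv.1 hvQ b hb hvb.symm).symm, hv⟩

/-- In a chordal graph, a clique each of whose vertices has a neighbour in `A` is dominated by
an independent subset of `A`. -/
theorem IsChordal.exists_isIndepSet_dominating {V : Type*} [Finite V] {G : SimpleGraph V}
    (hG : IsChordal G) (A : Set V) :
    ∀ Q : Set V, G.IsClique Q → Disjoint A Q → (∀ q ∈ Q, ∃ a ∈ A, G.Adj q a) →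
      ∃ S ⊆ A, _root_.IsIndepSet G S ∧ ∀ q ∈ Q, ∃ s ∈ S, G.Adj q s := by
  induction A using WellFoundedLT.induction with
  | _ A ih =>
  intro Q hQ hAQ hdom
  by_cases hA : A ∪ Q ⊆ Q
  · refine ⟨∅, Set.empty_subset _, Set.pairwise_empty _, fun q hq => ?_⟩
    obtain ⟨a, ha, -⟩ := hdom q hq
    exact (Set.disjoint_left.1 hAQ ha (hA (.inl ha))).elim
  obtain ⟨s, hsQ, hs, hsc⟩ := hG.exists_isSimplicialIn _ Q hQ hA
  have hsA : s ∈ A := hs.resolve_right hsQ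
  have hlt : A \ {s} < A :=
    lt_of_le_of_ne Set.sdiff_subset fun h => (h.symm ▸ hsA : s ∈ A \ {s}).2 rfl
  have hdisj : Disjoint (A \ {s}) Q := hAQ.mono_left Set.sdiff_subset
  by_cases hsn : ∃ a ∈ A, G.Adj s a
  · obtain ⟨a, ha, hsa⟩ := hsn
    obtain ⟨S, hSA, hS, hSd⟩ := ih _ hlt Q hQ hdisj fun q hq => by
      obtain ⟨c, hc, hqc⟩ := hdom q hq
      by_cases hcs : c = s
      · subst hcs
        refine ⟨a, ⟨ha, hsa.ne'⟩, hsc ⟨.inr hq, hqc.symm⟩ ⟨.inl ha, hsa⟩ ?_⟩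
        rintro rfl
        exact Set.disjoint_left.1 hAQ ha hq
      · exact ⟨c, ⟨hc, hcs⟩, hqc⟩
    exact ⟨S, hSA.trans Set.sdiff_subset, hS, hSd⟩
  · push Not at hsn
    obtain ⟨S, hSA, hS, hSd⟩ := ih _ hlt {q ∈ Q | ¬ G.Adj q s}
      (hQ.subset (Set.sep_subset _ _)) (hdisj.mono_right (Set.sep_subset _ _)) fun q hq => by
      obtain ⟨c, hc, hqc⟩ := hdom q hq.1
      refine ⟨c, ⟨hc, ?_⟩, hqc⟩
      rintro rfl
      exact hq.2 hqc
    refine ⟨insert s S, Set.insert_subset hsA (hSA.trans Set.sdiff_subset), ?_, ?_⟩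
    · refine Set.Pairwise.insert hS fun t ht _ => ?_
      have := hsn t (hSA ht).1
      exact ⟨this, fun h => this h.symm⟩
    · intro q hq
      by_cases hqs : G.Adj q s
      · exact ⟨s, Set.mem_insert _ _, hqs⟩
      · obtain ⟨t, ht, hqt⟩ := hSd q ⟨hq, hqs⟩
        exact ⟨t, Set.mem_insert_of_mem _ ht, hqt⟩

/-- `A` is a maximal independent set of the subgraph of `G` induced by `U`. -/
def IsMaxIndepIn {V : Type*} (G : SimpleGraph V) (U : Set V) (A : Finset V) : Prop :=
  (A : Set V) ⊆ U ∧ _root_.IsIndepSet G ↑A ∧ ∀ v ∈ U, v ∉ A → ∃ a ∈ A, G.Adj v a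

theorem isMaxIndepF_iff_isMaxIndepIn_univ {V : Type*} {G : SimpleGraph V} {A : Finset V} :
    IsMaxIndepF G A ↔ IsMaxIndepIn G Set.univ A := by
  classical
  constructor
  · rintro ⟨hA, hmax⟩
    refine ⟨Set.subset_univ _, hA, fun v _ hv => ?_⟩
    by_contra! h
    have := hmax (insert v A) (by
      rw [Finset.coe_insert]
      exact Set.Pairwise.insert hA fun a ha _ => ⟨h a ha, fun hh => h a ha hh.symm⟩)
      (Finset.subset_insert _ _)
    exact hv (this ▸ Finset.mem_insert_self v A)
  · rintro ⟨-, hA, hdom⟩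
    refine ⟨hA, fun B hB hAB => hAB.antisymm fun v hv => ?_⟩
    by_contra hvA
    obtain ⟨a, ha, hva⟩ := hdom v (Set.mem_univ _) hvA
    exact hB hv (hAB ha) hva.ne hva

theorem exists_isMaxIndepIn {V : Type*} [Finite V] {G : SimpleGraph V} {U S : Set V}
    (hSU : S ⊆ U) (hS : _root_.IsIndepSet G S) : ∃ A, IsMaxIndepIn G U A ∧ S ⊆ ↑A := by
  obtain ⟨B, hSB, ⟨hBU, hB⟩, hmax⟩ :=
    (Set.toFinite {B : Set V | B ⊆ U ∧ _root_.IsIndepSet G B}).exists_le_maximal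
      (show S ∈ _ from ⟨hSU, hS⟩)
  refine ⟨(Set.toFinite B).toFinset, ⟨by simpa using hBU, by simpa using hB, ?_⟩,
    by simpa using hSB⟩
  intro v hv hvB
  by_contra! h
  simp only [Set.Finite.mem_toFinset] at hvB h
  have hins : insert v B ∈ {B : Set V | B ⊆ U ∧ _root_.IsIndepSet G B} :=
    ⟨Set.insert_subset hv hBU,
      Set.Pairwise.insert hB fun a ha _ => ⟨h a ha, fun hh => h a ha hh.symm⟩⟩
  exact hvB (hmax hins (Set.subset_insert _ _) (Set.mem_insert _ _))

/-- A maximal independent set among the non-neighbours of `y` becomes a maximal independent set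
by adding `y`. -/
theorem IsMaxIndepIn.insert {V : Type*} [DecidableEq V] {G : SimpleGraph V} {U : Set V}
    {A : Finset V} {y : V} (hy : y ∈ U)
    (hA : IsMaxIndepIn G {v ∈ U | v ≠ y ∧ ¬ G.Adj y v} A) :
    IsMaxIndepIn G U (insert y A) := by
  obtain ⟨hAU, hAi, hAd⟩ := hA
  refine ⟨?_, ?_, ?_⟩
  · rw [Finset.coe_insert]
    exact Set.insert_subset hy fun a ha => (hAU ha).1
  · rw [Finset.coe_insert]
    exact Set.Pairwise.insert hAi fun a ha _ =>
      ⟨(hAU ha).2.2, fun h => (hAU ha).2.2 h.symm⟩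
  · intro v hv hvA
    rw [Finset.mem_insert, not_or] at hvA
    by_cases hyv : G.Adj y v
    · exact ⟨y, Finset.mem_insert_self _ _, hyv.symm⟩
    · obtain ⟨a, ha, hva⟩ := hAd v ⟨hv, hvA.1, hyv⟩ hvA.2
      exact ⟨a, Finset.mem_insert_of_mem ha, hva⟩

/-- All maximal independent sets of the subgraph induced by `U` have the same weight. -/
def IsWWellCoveredIn {V : Type*} (G : SimpleGraph V) (U : Set V) (w : V → ℝ) : Prop :=
  ∀ A B : Finset V, IsMaxIndepIn G U A → IsMaxIndepIn G U B → ∑ v ∈ A, w v = ∑ v ∈ B, w v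

theorem isWWellCovered_iff_isWWellCoveredIn_univ {V : Type*} {G : SimpleGraph V} {w : V → ℝ} :
    IsWWellCovered G w ↔ IsWWellCoveredIn G Set.univ w := by
  simp only [IsWWellCovered, IsWWellCoveredIn, isMaxIndepF_iff_isMaxIndepIn_univ]

/-- Deleting the simplicial vertices preserves well-coveredness if they have weight zero. -/
theorem IsWWellCoveredIn.diff_simplicial {V : Type*} [Finite V] {G : SimpleGraph V} {U : Set V}
    {w : V → ℝ} (hw : IsWWellCoveredIn G U w) (h0 : ∀ v, IsSimplicialIn G U v → w v = 0) :
    IsWWellCoveredIn G (U \ {v | IsSimplicialIn G U v}) w := by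
  have key : ∀ A, IsMaxIndepIn G (U \ {v | IsSimplicialIn G U v}) A →
      ∃ B, IsMaxIndepIn G U B ∧ ∑ v ∈ A, w v = ∑ v ∈ B, w v := by
    rintro A ⟨hAU, hAi, hAd⟩
    obtain ⟨B, hB, hAB⟩ := exists_isMaxIndepIn (hAU.trans Set.sdiff_subset) hAi
    refine ⟨B, hB, Finset.sum_subset hAB fun v hvB hvA => h0 v ?_⟩
    by_contra hs
    obtain ⟨a, ha, hva⟩ := hAd v ⟨hB.1 hvB, hs⟩ hvA
    exact hB.2.1 hvB (hAB ha) hva.ne hva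
  intro A B hA hB
  obtain ⟨A', hA', hAA'⟩ := key A hA
  obtain ⟨B', hB', hBB'⟩ := key B hB
  exact hAA'.trans ((hw A' B' hA' hB').trans hBB'.symm)

/-- In a chordal graph, if simplicial vertices have weight zero then so do the vertices that
become simplicial once the simplicial vertices are deleted. -/
theorem IsChordal.weight_eq_zero_of_isSimplicialIn_diff {V : Type*} [Finite V]
    {G : SimpleGraph V} (hG : IsChordal G) {U : Set V} {w : V → ℝ}
    (hw : IsWWellCoveredIn G U w) (h0 : ∀ v, IsSimplicialIn G U v → w v = 0) {y : V}
    (hy : IsSimplicialIn G (U \ {v | IsSimplicialIn G U v}) y) : w y = 0 := by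
  classical
  obtain ⟨⟨hyU, hyS⟩, hyc⟩ := hy
  set U₁ := U \ {v | IsSimplicialIn G U v}
  set D : Set V := {s | IsSimplicialIn G U s ∧ G.Adj y s}
  set Q : Set V := {q | q ∈ U₁ ∧ G.Adj y q ∧ ∀ s ∈ D, ¬ G.Adj q s}
  set A : Set V := {v ∈ U | v ≠ y ∧ ¬ G.Adj y v}
  have hDne : D.Nonempty := by
    by_contra hne
    refine hyS ⟨hyU, hyc.subset ?_⟩
    rintro v ⟨hv, hyv⟩
    exact ⟨⟨hv, fun hs => hne ⟨v, hs, hyv⟩⟩, hyv⟩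
  have hQc : G.IsClique Q := hyc.subset (by exact fun q hq => ⟨hq.1, hq.2.1⟩)
  have hQdom : ∀ q ∈ Q, ∃ a ∈ A, G.Adj q a := by
    rintro q ⟨hq, hyq, hqD⟩
    by_contra! hn
    have hyc' : G.IsClique (insert y (U₁ ∩ G.neighborSet y)) := hyc.insert fun b hb _ => hb.2
    refine hq.2 ⟨hq.1, hyc'.subset ?_⟩
    rintro u ⟨huU, hqu⟩
    by_cases huy : u = y
    · exact .inl huy
    have hyu : G.Adj y u := by
      by_contra h
      exact hn u ⟨huU, huy, h⟩ hqu
    exact .inr ⟨⟨huU, fun hs => hqD u ⟨hs, hyu⟩ hqu⟩, hyu⟩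
  obtain ⟨S₀, hS₀A, hS₀, hS₀d⟩ := hG.exists_isIndepSet_dominating A Q hQc
    (Set.disjoint_left.2 fun v hv hvQ => hv.2.2 hvQ.2.1) hQdom
  obtain ⟨S, hS, hS₀S⟩ := exists_isMaxIndepIn hS₀A hS₀
  obtain ⟨T, hT, -⟩ := exists_isMaxIndepIn (G := G) (Set.empty_subset D) (Set.pairwise_empty _)
  have hTS : ∀ t ∈ T, ∀ s ∈ S, ¬ G.Adj t s := by
    intro t ht s hs hts
    have htD := hT.1 ht
    have hsA := hS.1 hs
    exact hsA.2.2 (htD.1.2 ⟨hyU, htD.2.symm⟩ ⟨hsA.1, hts⟩ hsA.2.1.symm)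
  have hTU : IsMaxIndepIn G U (T ∪ S) := by
    refine ⟨?_, ?_, ?_⟩
    · rw [Finset.coe_union]
      exact Set.union_subset (fun t ht => (hT.1 ht).1.1) fun s hs => (hS.1 hs).1
    · rw [Finset.coe_union]
      rintro a (ha | ha) b (hb | hb) hab
      · exact hT.2.1 ha hb hab
      · exact hTS a ha b hb
      · exact fun h => hTS b hb a ha h.symm
      · exact hS.2.1 ha hb hab
    · intro v hv hvTS
      rw [Finset.mem_union, not_or] at hvTS
      suffices (∃ t ∈ T, G.Adj v t) ∨ ∃ s ∈ S, G.Adj v s by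
        rcases this with ⟨t, ht, h⟩ | ⟨s, hs, h⟩
        · exact ⟨t, Finset.mem_union_left _ ht, h⟩
        · exact ⟨s, Finset.mem_union_right _ hs, h⟩
      by_cases hvy : v = y
      · subst hvy
        obtain ⟨d, hd⟩ := hDne
        left
        by_cases hdT : d ∈ T
        · exact ⟨d, hdT, hd.2⟩
        · obtain ⟨t, ht, -⟩ := hT.2.2 d hd hdT
          exact ⟨t, ht, (hT.1 ht).2⟩
      by_cases hyv : G.Adj y v
      · by_cases hvs : IsSimplicialIn G U v
        · exact .inl (hT.2.2 v ⟨hvs, hyv⟩ hvTS.1)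
        by_cases hvQ : v ∈ Q
        · obtain ⟨s, hs, hvs⟩ := hS₀d v hvQ
          exact .inr ⟨s, hS₀S hs, hvs⟩
        · obtain ⟨d, hd, hvd⟩ : ∃ d ∈ D, G.Adj v d := by
            by_contra! h
            exact hvQ ⟨⟨hv, hvs⟩, hyv, h⟩
          left
          by_cases hdT : d ∈ T
          · exact ⟨d, hdT, hvd⟩
          · obtain ⟨t, ht, hdt⟩ := hT.2.2 d hd hdT
            refine ⟨t, ht, hd.1.2 ⟨hv, hvd.symm⟩ ⟨(hT.1 ht).1.1, hdt⟩ ?_⟩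
            rintro rfl
            exact hvs (hT.1 ht).1
      · exact .inr (hS.2.2 v ⟨hv, hvy, hyv⟩ hvTS.2)
  have hsum := hw _ _ (hS.insert hyU) hTU
  have hdisj : Disjoint T S :=
    Finset.disjoint_left.2 fun t ht hs => (hS.1 hs).2.2 (hT.1 ht).2
  rw [Finset.sum_insert fun h => (hS.1 h).2.1 rfl, Finset.sum_union hdisj,
    Finset.sum_eq_zero fun t ht => h0 t (hT.1 ht).1] at hsum
  linarith

/-- A weight function of a well-covered chordal graph is determined by its values on the
simplicial vertices. -/
theorem IsChordal.weight_eq_zero {V : Type*} [Finite V] {G : SimpleGraph V} (hG : IsChordal G)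
    {w : V → ℝ} (U : Set V) : IsWWellCoveredIn G U w →
      (∀ v, IsSimplicialIn G U v → w v = 0) → ∀ v ∈ U, w v = 0 := by
  induction U using WellFoundedLT.induction with
  | _ U ih =>
  intro hw h0 v hv
  by_cases hvs : IsSimplicialIn G U v
  · exact h0 v hvs
  obtain ⟨s, -, hs⟩ := hG.exists_isSimplicialIn U ∅ (Set.pairwise_empty _) fun h => h hv
  refine ih _ (lt_of_le_of_ne Set.sdiff_subset fun h => ?_) (hw.diff_simplicial h0)
    (fun y hy => hG.weight_eq_zero_of_isSimplicialIn_diff hw h0 hy) v ⟨hv, hvs⟩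
  exact (h.symm ▸ hs.1 : s ∈ U \ {v | IsSimplicialIn G U v}).2 hs

theorem isSimplicialIn_univ_iff {V : Type*} {G : SimpleGraph V} {v : V} :
    IsSimplicialIn G Set.univ v ↔ IsSimplicialVertex G v := by
  simp only [IsSimplicialIn, Set.mem_univ, Set.univ_inter, true_and, IsSimplicialVertex]
  exact ⟨fun h => h.insert fun b hb _ => hb, fun h => h.subset (Set.subset_insert _ _)⟩

/-- A simplicial clique is the closed neighbourhood of each of its simplicial vertices. -/
theorem IsSimplicialClique.eq_insert_neighborSet {V : Type*} {G : SimpleGraph V} {C : Set V}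
    (hC : IsSimplicialClique G C) {v : V} (hvC : v ∈ C) (hv : IsSimplicialVertex G v) :
    C = insert v (G.neighborSet v) :=
  hC.2.1 _ hv fun _ hu => or_iff_not_imp_left.2 fun huv => hC.1 hvC hu (Ne.symm huv)

theorem IsSimplicialVertex.isSimplicialClique {V : Type*} {G : SimpleGraph V} {v : V}
    (hv : IsSimplicialVertex G v) : IsSimplicialClique G (insert v (G.neighborSet v)) :=
  ⟨hv, fun _ hD hvD => hvD.antisymm fun _ hu => or_iff_not_imp_left.2 fun huv =>
    hD (hvD (Set.mem_insert _ _)) hu (Ne.symm huv), v, Set.mem_insert _ _, hv⟩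

/-- A simplicial clique meets every maximal independent set in exactly one vertex. -/
theorem IsSimplicialClique.sum_indicator_eq_one {V : Type*} {G : SimpleGraph V} {C : Set V}
    (hC : IsSimplicialClique G C) {A : Finset V} (hA : IsMaxIndepIn G Set.univ A) :
    ∑ v ∈ A, C.indicator (fun _ => (1 : ℝ)) v = 1 := by
  obtain ⟨v, hvC, hv⟩ := hC.2.2
  obtain ⟨a, haA, haC⟩ : ∃ a ∈ A, a ∈ C := by
    by_cases hvA : v ∈ A
    · exact ⟨v, hvA, hvC⟩
    · obtain ⟨a, haA, hva⟩ := hA.2.2 v (Set.mem_univ v) hvA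
      exact ⟨a, haA, hC.eq_insert_neighborSet hvC hv ▸ Set.mem_insert_of_mem _ hva⟩
  rw [Finset.sum_eq_single_of_mem a haA fun b hbA hba => Set.indicator_of_notMem
    (fun hbC => hA.2.1 hbA haA hba (hC.1 hbC haC hba)) _, Set.indicator_of_mem haC]

/-- Vertices with the same closed neighbourhood have the same weight. -/
theorem IsWWellCoveredIn.eq_of_closedNeighborSet_eq {V : Type*} [Finite V] {G : SimpleGraph V}
    {w : V → ℝ} (hw : IsWWellCoveredIn G Set.univ w) {u v : V}
    (h : insert v (G.neighborSet v) = insert u (G.neighborSet u)) : w v = w u := by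
  classical
  have hset : ∀ x : V, {y ∈ Set.univ | y ≠ x ∧ ¬ G.Adj x y} =
      (insert x (G.neighborSet x))ᶜ := by
    intro x
    ext y
    simp
  obtain ⟨S, hS, -⟩ := exists_isMaxIndepIn (G := G)
    (Set.empty_subset {y ∈ Set.univ | y ≠ v ∧ ¬ G.Adj v y}) (Set.pairwise_empty _)
  have hS' : IsMaxIndepIn G {y ∈ Set.univ | y ≠ u ∧ ¬ G.Adj u y} S := by
    rwa [hset, ← h, ← hset]
  have hsum := hw _ _ (hS.insert (Set.mem_univ v)) (hS'.insert (Set.mem_univ u))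
  rw [Finset.sum_insert fun hv => (hS.1 hv).2.1 rfl,
    Finset.sum_insert fun hu => (hS'.1 hu).2.1 rfl] at hsum
  linarith

/-- For a chordal graph `G`, `dim WCW(G) = sc(G)`, and the characteristic functions of
the simplicial cliques form a basis of `WCW(G)` (they are linearly independent and
span `WCW(G)`). -/
theorem stmt19 {V : Type*} [Fintype V] (G : SimpleGraph V) (hG : IsChordal G)
    (W : Submodule ℝ (V → ℝ)) (hW : (W : Set (V → ℝ)) = {w | IsWWellCovered G w}) :
    Module.finrank ℝ W = Nat.card {C : Set V // IsSimplicialClique G C} ∧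
    LinearIndependent ℝ
      (fun C : {C : Set V // IsSimplicialClique G C} =>
        (C : Set V).indicator fun _ => (1 : ℝ)) ∧
    Submodule.span ℝ
      {f : V → ℝ | ∃ C, IsSimplicialClique G C ∧ f = C.indicator fun _ => (1 : ℝ)} = W := by
  classical
  have hWmem : ∀ w : V → ℝ, w ∈ W ↔ IsWWellCoveredIn G Set.univ w := fun w => by
    rw [← isWWellCovered_iff_isWWellCoveredIn_univ, ← SetLike.mem_coe, hW, Set.mem_ofPred_eq]
  let f : {C : Set V // IsSimplicialClique G C} → V → ℝ :=
    fun C => (C : Set V).indicator fun _ => (1 : ℝ)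
  choose r hrC hr using fun C : {C : Set V // IsSimplicialClique G C} => C.2.2.2
  have hfr : ∀ C D, f C (r D) = if C = D then 1 else 0 := by
    intro C D
    split_ifs with h
    · subst h
      exact Set.indicator_of_mem (hrC C) _
    · refine Set.indicator_of_notMem (fun hm => h (Subtype.ext ?_)) _
      rw [C.2.eq_insert_neighborSet hm (hr D), D.2.eq_insert_neighborSet (hrC D) (hr D)]
  have hlin : LinearIndependent ℝ f := by
    rw [Fintype.linearIndependent_iff]
    intro g hg D
    simpa [Finset.sum_apply, hfr] using congrFun hg (r D)
  have hfW : ∀ C, f C ∈ W := fun C => (hWmem _).2 fun A B hA hB => by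
    rw [C.2.sum_indicator_eq_one hA, C.2.sum_indicator_eq_one hB]
  have hspan : Submodule.span ℝ (Set.range f) = W := by
    refine le_antisymm (Submodule.span_le.2 (Set.range_subset_iff.2 hfW)) fun w hw => ?_
    have hsum : ∑ C, w (r C) • f C ∈ Submodule.span ℝ (Set.range f) :=
      Submodule.sum_mem _ fun C _ => Submodule.smul_mem _ _ (Submodule.subset_span ⟨C, rfl⟩)
    have hmem : w - ∑ C, w (r C) • f C ∈ W :=
      W.sub_mem hw (W.sum_mem fun C _ => W.smul_mem _ (hfW C))
    have hzero : ∀ v, (w - ∑ C, w (r C) • f C) v = 0 := by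
      refine fun v => hG.weight_eq_zero Set.univ ((hWmem _).1 hmem) (fun v hv => ?_) v
        (Set.mem_univ v)
      have hvs : IsSimplicialVertex G v := isSimplicialIn_univ_iff.1 hv
      let C : {C : Set V // IsSimplicialClique G C} := ⟨_, hvs.isSimplicialClique⟩
      rw [((hWmem _).1 hmem).eq_of_closedNeighborSet_eq (v := v) (u := r C)
        (C.2.eq_insert_neighborSet (hrC C) (hr C))]
      simp [Finset.sum_apply, hfr]
    rwa [sub_eq_zero.1 (funext hzero : w - ∑ C, w (r C) • f C = 0)]
  refine ⟨?_, hlin, ?_⟩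
  · rw [← hspan, finrank_span_eq_card hlin, Nat.card_eq_fintype_card]
  · rw [← hspan]
    congr 1
    ext g
    simp [f, eq_comm]
end
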